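/- arXiv:1102.3616 — 2 statements merged into one kernel-verified Lean document; each statement's English description precedes it below -/
import Mathlib

section
/- Let γ > 0 and define l_γ(z) = log h(z) − γ log z for z ∈ (0,1), where h(z) = Σ_{r ∈ ℤ} z^{r²}. Then: (i) there is a unique solution z_γ ∈ (0,1) of the equation l_γ'(z) = 0; (ii) the map γ ↦ z_γ is strictly increasing on (0,∞); (iii) l_γ''(z_γ) > 0. -/
open Real Set

/-- The Jacobi theta function `h(z) = Σ_{r ∈ ℤ} z^{r²}` for real `0 < z < 1`
(since `r² ≥ 0` we use the natural-number exponent `(r²).toNat`). -/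
noncomputable def jacobiH (z : ℝ) : ℝ := ∑' r : ℤ, z ^ (r ^ 2).toNat

/-- `l_γ(z) = log h(z) − γ log z`. -/
noncomputable def lgam (γ : ℝ) (z : ℝ) : ℝ := Real.log (jacobiH z) - γ * Real.log z

/-- The `j`-th moment `Σ_{r ∈ ℤ} (r²)^j z^{r²}` of the theta weights. -/
noncomputable def thetaMoment (j : ℕ) (z : ℝ) : ℝ :=
  ∑' r : ℤ, (((r ^ 2).toNat : ℕ) : ℝ) ^ j * z ^ (r ^ 2).toNat

/-- The mean `z h'(z) / h(z)` of `r²` under the theta weights. -/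
noncomputable def thetaMean (z : ℝ) : ℝ := thetaMoment 1 z / thetaMoment 0 z

lemma jacobiH_eq_thetaMoment_zero : jacobiH = thetaMoment 0 := by
  funext z
  simp [jacobiH, thetaMoment]

lemma summable_comp_sq_toNat {f : ℕ → ℝ} (hf : Summable f) :
    Summable fun r : ℤ => f (r ^ 2).toNat := by
  have hinj : Function.Injective fun n : ℕ => n ^ 2 := Nat.pow_left_injective (by norm_num)
  have h : ∀ n : ℕ, ((n : ℤ) ^ 2).toNat = n ^ 2 := fun n => by
    rw [← Nat.cast_pow, Int.toNat_natCast]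
  refine Summable.of_nat_of_neg ?_ ?_
  · simpa only [h, Function.comp_def] using hf.comp_injective hinj
  · simpa only [neg_sq, h, Function.comp_def] using hf.comp_injective hinj

lemma summable_thetaMoment (j : ℕ) {z : ℝ} (hz : |z| < 1) :
    Summable fun r : ℤ => (((r ^ 2).toNat : ℕ) : ℝ) ^ j * z ^ (r ^ 2).toNat :=
  summable_comp_sq_toNat (f := fun n : ℕ => (n : ℝ) ^ j * z ^ n)
    (summable_pow_mul_geometric_of_norm_lt_one j (by simpa using hz))

lemma hasDerivAt_thetaMoment_tsum (j : ℕ) {z : ℝ} (hz : |z| < 1) :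
    HasDerivAt (thetaMoment j) (∑' r : ℤ, (((r ^ 2).toNat : ℕ) : ℝ) ^ j *
      (((r ^ 2).toNat : ℕ) * z ^ ((r ^ 2).toNat - 1))) z := by
  obtain ⟨ρ, hzρ, hρ⟩ := exists_between hz
  have hρ0 : 0 < ρ := (abs_nonneg z).trans_lt hzρ
  have hu : Summable fun n : ℕ => (n : ℝ) ^ j * (n * ρ ^ (n - 1)) := by
    have h := (summable_pow_mul_geometric_of_norm_lt_one (j + 1)
      (r := ρ) (by rwa [Real.norm_of_nonneg hρ0.le])).mul_right ρ⁻¹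
    refine h.congr fun n => ?_
    rcases n with _ | n
    · simp
    · simp only [Nat.add_sub_cancel]
      field_simp
      ring
  refine hasDerivAt_tsum_of_isPreconnected (summable_comp_sq_toNat hu)
    (t := Metric.ball 0 ρ) (y₀ := z) Metric.isOpen_ball (convex_ball 0 ρ).isPreconnected
    (fun r y _ => (hasDerivAt_pow _ y).const_mul _) (fun r y hy => ?_)
    (by simpa using hzρ) (summable_thetaMoment j hz) (by simpa using hzρ)
  have hy' : |y| ≤ ρ := by simpa using (mem_ball_zero_iff.mp hy).le
  rw [norm_mul, norm_mul, norm_pow, norm_pow, Real.norm_natCast, Real.norm_eq_abs]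
  gcongr

lemma hasDerivAt_thetaMoment (j : ℕ) {z : ℝ} (hz : z ∈ Ioo (0 : ℝ) 1) :
    HasDerivAt (thetaMoment j) (thetaMoment (j + 1) z / z) z := by
  convert hasDerivAt_thetaMoment_tsum j (z := z) (by rw [abs_of_pos hz.1]; exact hz.2) using 1
  rw [thetaMoment, ← tsum_div_const]
  refine tsum_congr fun r => ?_
  have hz0 := hz.1.ne'
  rcases (r ^ 2).toNat with _ | n
  · simp
  · simp only [Nat.add_sub_cancel]
    field_simp
    ring

lemma continuousAt_thetaMoment (j : ℕ) {z : ℝ} (hz : |z| < 1) :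
    ContinuousAt (thetaMoment j) z :=
  (hasDerivAt_thetaMoment_tsum j hz).continuousAt

lemma thetaMoment_pos (j : ℕ) {z : ℝ} (hz : z ∈ Ioo (0 : ℝ) 1) : 0 < thetaMoment j z := by
  have hz0 := hz.1
  refine (summable_thetaMoment j (by rw [abs_of_pos hz.1]; exact hz.2)).tsum_pos
    (fun r => by positivity) 1 (by simpa using hz0)

lemma thetaMoment_zero_pos {z : ℝ} (hz : z ∈ Ico (0 : ℝ) 1) : 0 < thetaMoment 0 z := by
  have hz0 := hz.1
  exact (summable_thetaMoment 0 (by rw [abs_of_nonneg hz.1]; exact hz.2)).tsum_pos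
    (fun r => by positivity) 0 (by simp)

lemma thetaMoment_one_zero : thetaMoment 1 0 = 0 := by
  rw [thetaMoment, ← tsum_zero (β := ℤ)]
  refine tsum_congr fun r => ?_
  rcases (r ^ 2).toNat with _ | n <;> simp

/-- The variance of `r²` under the theta weights is positive. -/
lemma thetaMoment_one_sq_lt {z : ℝ} (hz : z ∈ Ioo (0 : ℝ) 1) :
    thetaMoment 1 z ^ 2 < thetaMoment 2 z * thetaMoment 0 z := by
  have hz0 := hz.1
  have hz1 : |z| < 1 := by rw [abs_of_pos hz.1]; exact hz.2
  have h0 := thetaMoment_pos 0 hz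
  have h1 := thetaMoment_pos 1 hz
  set m := thetaMoment 1 z / thetaMoment 0 z with hm
  have hm0 : 0 < m := div_pos h1 h0
  have hsum : HasSum (fun r : ℤ => ((((r ^ 2).toNat : ℕ) : ℝ) - m) ^ 2 * z ^ (r ^ 2).toNat)
      (thetaMoment 2 z - 2 * m * thetaMoment 1 z + m ^ 2 * thetaMoment 0 z) := by
    have h := ((summable_thetaMoment 2 hz1).hasSum.sub
      ((summable_thetaMoment 1 hz1).hasSum.mul_left (2 * m))).add
      ((summable_thetaMoment 0 hz1).hasSum.mul_left (m ^ 2))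
    refine h.congr_fun fun r => ?_
    ring
  have hpos : 0 < thetaMoment 2 z - 2 * m * thetaMoment 1 z + m ^ 2 * thetaMoment 0 z := by
    rw [← hsum.tsum_eq]
    exact hsum.summable.tsum_pos (fun r => by positivity) 0 (by simpa using pow_pos hm0 2)
  have hm1 : thetaMoment 1 z = m * thetaMoment 0 z := by rw [hm]; field_simp
  rw [hm1] at hpos ⊢
  nlinarith [mul_pos hpos h0]

lemma exists_deriv_thetaMean_pos {z : ℝ} (hz : z ∈ Ioo (0 : ℝ) 1) :
    ∃ d, 0 < d ∧ HasDerivAt thetaMean d z := by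
  have h0 := thetaMoment_pos 0 hz
  refine ⟨_, ?_, (hasDerivAt_thetaMoment 1 hz).div (hasDerivAt_thetaMoment 0 hz) h0.ne'⟩
  have hvar := thetaMoment_one_sq_lt hz
  have hz0 := hz.1
  refine div_pos ?_ (by positivity)
  have : thetaMoment (1 + 1) z / z * thetaMoment 0 z - thetaMoment 1 z *
      (thetaMoment (0 + 1) z / z) =
      (thetaMoment 2 z * thetaMoment 0 z - thetaMoment 1 z ^ 2) / z := by
    norm_num
    ring
  rw [this]
  exact div_pos (sub_pos.mpr hvar) hz0

lemma strictMonoOn_thetaMean : StrictMonoOn thetaMean (Ioo 0 1) := by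
  refine strictMonoOn_of_deriv_pos (convex_Ioo 0 1) (fun z hz => ?_) fun z hz => ?_
  · obtain ⟨d, -, hd⟩ := exists_deriv_thetaMean_pos hz
    exact hd.continuousAt.continuousWithinAt
  · rw [interior_Ioo] at hz
    obtain ⟨d, hd0, hd⟩ := exists_deriv_thetaMean_pos hz
    rwa [hd.deriv]

lemma exists_lt_thetaMean {γ : ℝ} (hγ : 0 < γ) : ∃ z ∈ Ioo (0 : ℝ) 1, γ < thetaMean z := by
  obtain ⟨m, hm⟩ := exists_nat_gt (γ + 1)
  obtain ⟨L, hL⟩ := exists_nat_gt ((γ + 1) * (2 * m + 1))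
  have hcast : ∀ r : ℤ, (((r ^ 2).toNat : ℕ) : ℝ) = (r : ℝ) ^ 2 := fun r => by
    have h : (((r ^ 2).toNat : ℕ) : ℤ) = r ^ 2 := Int.toNat_of_nonneg (sq_nonneg r)
    exact_mod_cast congrArg (Int.cast : ℤ → ℝ) h
  have hout : ∀ r : ℤ, r ∉ Finset.Icc (-(m : ℤ)) m →
      γ + 1 ≤ (((r ^ 2).toNat : ℕ) : ℝ) := fun r hr => by
    have hr' : (m : ℤ) < |r| := by
      by_contra! h
      exact hr (Finset.mem_Icc.mpr (abs_le.mp h))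
    have hr'' : (m : ℝ) < |(r : ℝ)| := by exact_mod_cast hr'
    rw [hcast, ← sq_abs]
    nlinarith
  set F : Finset ℤ := Finset.Icc (-((m : ℤ) + L)) (m + L) with hF
  have hsub : Finset.Icc (-(m : ℤ)) m ⊆ F := Finset.Icc_subset_Icc (by omega) (by omega)
  let P : ℝ → ℝ := fun z => ∑ r ∈ F, ((((r ^ 2).toNat : ℕ) : ℝ) - γ) * z ^ (r ^ 2).toNat
  have hP1 : 0 < P 1 := by
    have hle : ∑ r ∈ F, (1 - if r ∈ Finset.Icc (-(m : ℤ)) m then γ + 1 else 0) ≤ P 1 := by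
      refine Finset.sum_le_sum fun r _ => ?_
      rw [one_pow, mul_one]
      split_ifs with h
      · have : (0 : ℝ) ≤ (((r ^ 2).toNat : ℕ) : ℝ) := Nat.cast_nonneg _
        linarith
      · linarith [hout r h]
    refine lt_of_lt_of_le ?_ hle
    have hcF : (F.card : ℝ) = 2 * (m + L) + 1 := by
      have : F.card = 2 * (m + L) + 1 := by rw [hF, Int.card_Icc]; omega
      rw [this]; push_cast; ring
    have hcm : ((Finset.Icc (-(m : ℤ)) m).card : ℝ) = 2 * m + 1 := by
      have : (Finset.Icc (-(m : ℤ)) m).card = 2 * m + 1 := by rw [Int.card_Icc]; omega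
      rw [this]; push_cast; ring
    rw [Finset.sum_sub_distrib, Finset.sum_ite_mem, Finset.inter_eq_right.mpr hsub,
      Finset.sum_const, Finset.sum_const, nsmul_eq_mul, nsmul_eq_mul, hcF, hcm]
    have : (0 : ℝ) ≤ L := Nat.cast_nonneg _
    have : (0 : ℝ) ≤ m := Nat.cast_nonneg _
    linarith
  have hPc : Continuous P := by fun_prop
  have hev : ∀ᶠ z in nhdsWithin (1 : ℝ) (Iio 1), 0 < P z :=
    (hPc.continuousAt.eventually (lt_mem_nhds hP1)).filter_mono nhdsWithin_le_nhds
  obtain ⟨z, hPz, hz⟩ := (hev.and (Ioo_mem_nhdsLT (zero_lt_one (α := ℝ)))).exists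
  refine ⟨z, hz, ?_⟩
  have hz0 := hz.1
  have hz1 : |z| < 1 := by rw [abs_of_pos hz.1]; exact hz.2
  rw [thetaMean, lt_div_iff₀ (thetaMoment_pos 0 hz), ← sub_pos]
  have hsum : HasSum (fun r : ℤ => ((((r ^ 2).toNat : ℕ) : ℝ) - γ) * z ^ (r ^ 2).toNat)
      (thetaMoment 1 z - γ * thetaMoment 0 z) := by
    have h := (summable_thetaMoment 1 hz1).hasSum.sub
      ((summable_thetaMoment 0 hz1).hasSum.mul_left γ)
    refine h.congr_fun fun r => ?_
    ring
  refine hPz.trans_le (sum_le_hasSum F (fun r hr => ?_) hsum)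
  have := hout r fun h => hr (hsub h)
  exact mul_nonneg (by linarith) (by positivity)

lemma exists_thetaMean_eq {γ : ℝ} (hγ : 0 < γ) : ∃ z ∈ Ioo (0 : ℝ) 1, thetaMean z = γ := by
  obtain ⟨w, hw, hγw⟩ := exists_lt_thetaMean hγ
  have hcont : ContinuousOn thetaMean (Icc 0 w) := fun z hz => by
    have hz1 : z < 1 := hz.2.trans_lt hw.2
    have habs : |z| < 1 := by rwa [abs_of_nonneg hz.1]
    exact ((continuousAt_thetaMoment 1 habs).div (continuousAt_thetaMoment 0 habs)
      (thetaMoment_zero_pos ⟨hz.1, hz1⟩).ne').continuousWithinAt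
  have h0 : thetaMean 0 = 0 := by rw [thetaMean, thetaMoment_one_zero, zero_div]
  obtain ⟨z, hz, hzγ⟩ := intermediate_value_Ioo hw.1.le hcont ⟨by rwa [h0], hγw⟩
  exact ⟨z, ⟨hz.1, hz.2.trans hw.2⟩, hzγ⟩

lemma deriv_lgam (γ : ℝ) {z : ℝ} (hz : z ∈ Ioo (0 : ℝ) 1) :
    deriv (lgam γ) z = (thetaMean z - γ) / z := by
  have h0 := thetaMoment_pos 0 hz
  have h := ((hasDerivAt_thetaMoment 0 hz).log h0.ne').sub
    ((Real.hasDerivAt_log hz.1.ne').const_mul γ)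
  rw [← jacobiH_eq_thetaMoment_zero] at h
  have hd : deriv (lgam γ) z = _ := h.deriv
  rw [hd, thetaMean, jacobiH_eq_thetaMoment_zero]
  have hz0 := hz.1.ne'
  field_simp

lemma deriv_lgam_eq_zero_iff (γ : ℝ) {z : ℝ} (hz : z ∈ Ioo (0 : ℝ) 1) :
    deriv (lgam γ) z = 0 ↔ thetaMean z = γ := by
  rw [deriv_lgam γ hz, div_eq_zero_iff, sub_eq_zero, or_iff_left hz.1.ne']

lemma deriv_deriv_lgam_pos {γ z : ℝ} (hz : z ∈ Ioo (0 : ℝ) 1) (hγ : thetaMean z = γ) :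
    0 < deriv (deriv (lgam γ)) z := by
  obtain ⟨d, hd0, hd⟩ := exists_deriv_thetaMean_pos hz
  have hev : deriv (lgam γ) =ᶠ[nhds z] fun w => (thetaMean w - γ) / w :=
    Filter.eventually_of_mem (isOpen_Ioo.mem_nhds hz) fun w hw => deriv_lgam γ hw
  have hz0 := hz.1
  have h : HasDerivAt (fun w => (thetaMean w - γ) / w) _ z :=
    (hd.sub_const γ).div (hasDerivAt_id z) hz0.ne'
  rw [hev.deriv_eq, h.deriv, hγ]
  simp only [sub_self, zero_mul, sub_zero]
  positivity

/-- For every `γ > 0`: (i) there is a unique `z_γ ∈ (0,1)` solving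
`l_γ'(z) = 0`; (ii) the map `γ ↦ z_γ` is strictly increasing on `(0,∞)`;
(iii) `l_γ''(z_γ) > 0`. -/
theorem saddle_point_exists_unique_strictMono :
    (∀ γ : ℝ, 0 < γ → ∃! z : ℝ, z ∈ Set.Ioo (0 : ℝ) 1 ∧ deriv (lgam γ) z = 0) ∧
    ∀ zsel : ℝ → ℝ,
      (∀ γ : ℝ, 0 < γ → zsel γ ∈ Set.Ioo (0 : ℝ) 1 ∧ deriv (lgam γ) (zsel γ) = 0) →
      StrictMonoOn zsel (Set.Ioi 0) ∧
        ∀ γ : ℝ, 0 < γ → 0 < deriv (deriv (lgam γ)) (zsel γ) := by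
  refine ⟨fun γ hγ => ?_, fun zsel hsel => ?_⟩
  · obtain ⟨z, hz, hzγ⟩ := exists_thetaMean_eq hγ
    refine ⟨z, ⟨hz, (deriv_lgam_eq_zero_iff γ hz).mpr hzγ⟩, fun w hw => ?_⟩
    exact strictMonoOn_thetaMean.injOn hw.1 hz
      (((deriv_lgam_eq_zero_iff γ hw.1).mp hw.2).trans hzγ.symm)
  · have hmean : ∀ γ, 0 < γ → thetaMean (zsel γ) = γ := fun γ hγ =>
      (deriv_lgam_eq_zero_iff γ (hsel γ hγ).1).mp (hsel γ hγ).2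
    refine ⟨fun a ha b hb hab => ?_, fun γ hγ => deriv_deriv_lgam_pos (hsel γ hγ).1 (hmean γ hγ)⟩
    rwa [← strictMonoOn_thetaMean.lt_iff_lt (hsel a ha).1 (hsel b hb).1, hmean a ha, hmean b hb]
end

section
/- Fix a positive rational number γ and let z_γ ∈ (0,1) be the unique solution of l_γ'(z) = 0. Then, as d → ∞ along positive integers d such that γd is an integer, N₁(d,γ) · (z_γ^γ / h(z_γ))^d · z_γ (1 − z_γ) (2 l_γ''(z_γ) π d)^{1/2} → 1; equivalently, N₁(d,γ) = (h(z_γ)/z_γ^γ)^d · (1 + o(1)) / ( z_γ (1 − z_γ) (2 l_γ''(z_γ) π d)^{1/2} ). -/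
open Real Set Filter

/-- `N₁(d,γ) = #{k ∈ ℤ^d : k₁² + … + k_d² ≤ γ d}`. -/
noncomputable def N1 (d : ℕ) (γ : ℝ) : ℕ :=
  Set.ncard {k : Fin d → ℤ | (∑ i, ((k i : ℝ)) ^ 2) ≤ γ * d}

/-- The filter of `d → ∞` along positive integers `d` such that `γ d` is an integer. -/
def alongIntMultiples (γ : ℚ) : Filter ℕ :=
  Filter.atTop ⊓ Filter.principal {d : ℕ | ∃ m : ℤ, (γ : ℝ) * d = (m : ℝ)}

lemma toNat_sq_eq (r : ℤ) : (r ^ 2).toNat = r.natAbs ^ 2 := by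
  zify
  rw [Int.toNat_of_nonneg (sq_nonneg r), sq_abs]

/-- The theta series converges absolutely on `[0, 1)`. -/
lemma summable_pow_sq {x : ℝ} (h0 : 0 ≤ x) (h1 : x < 1) :
    Summable fun r : ℤ => x ^ (r ^ 2).toNat := by
  have key : Summable fun n : ℕ => x ^ (n ^ 2) :=
    (summable_geometric_of_lt_one h0 h1).of_nonneg_of_le (fun n => by positivity)
      (fun n => pow_le_pow_of_le_one h0 h1.le (Nat.le_self_pow two_ne_zero n))
  refine Summable.of_nat_of_neg ?_ ?_ <;> simpa [toNat_sq_eq] using key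

/-- The complex extension of `jacobiH` to the unit disc. -/
noncomputable def complexTheta (w : ℂ) : ℂ := ∑' r : ℤ, w ^ (r ^ 2).toNat

lemma summable_norm_complexTheta {w : ℂ} (hw : ‖w‖ < 1) :
    Summable fun r : ℤ => ‖w ^ (r ^ 2).toNat‖ := by
  simpa using summable_pow_sq (norm_nonneg w) hw

lemma complexTheta_ofReal (x : ℝ) : complexTheta x = jacobiH x := by
  simp [complexTheta, jacobiH, Complex.ofReal_tsum]

lemma differentiableOn_complexTheta : DifferentiableOn ℂ complexTheta (Metric.ball 0 1) := by
  intro w hw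
  obtain ⟨r, hr, hr1⟩ := exists_between (mem_ball_zero_iff.1 hw)
  refine ((Complex.differentiableOn_tsum_of_summable_norm
    (summable_pow_sq ((norm_nonneg w).trans hr.le) hr1) (fun i => by fun_prop)
    Metric.isOpen_ball (fun i v hv => ?_)).differentiableAt
      (Metric.isOpen_ball.mem_nhds (mem_ball_zero_iff.2 hr))).differentiableWithinAt
  rw [norm_pow]
  exact pow_le_pow_left₀ (norm_nonneg v) (mem_ball_zero_iff.1 hv).le _

lemma jacobiH_ge {x : ℝ} (h0 : 0 ≤ x) (h1 : x < 1) : 1 + 2 * x ≤ jacobiH x := by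
  have h := (summable_pow_sq h0 h1).sum_le_tsum ({0, 1, -1} : Finset ℤ) (fun i _ => by positivity)
  norm_num at h
  rw [jacobiH]
  linarith

lemma jacobiH_pos {x : ℝ} (h0 : 0 ≤ x) (h1 : x < 1) : 0 < jacobiH x := by
  linarith [jacobiH_ge h0 h1]

/-- Splitting off the terms `r ∈ {0, 1, -1}` of the theta series. -/
lemma norm_complexTheta_le {w : ℂ} (hw : ‖w‖ < 1) :
    ‖complexTheta w‖ ≤ ‖1 + 2 * w‖ + (jacobiH ‖w‖ - (1 + 2 * ‖w‖)) := by
  have hs := summable_norm_complexTheta hw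
  have h1 := hs.of_norm.sum_add_tsum_compl (s := ({0, 1, -1} : Finset ℤ))
  have h2 := (summable_pow_sq (norm_nonneg w) hw).sum_add_tsum_compl
    (s := ({0, 1, -1} : Finset ℤ))
  norm_num at h1 h2
  rw [complexTheta, jacobiH, ← h1, ← h2]
  have h3 : ‖∑' x : ((({0, 1, -1} : Finset ℤ) : Set ℤ)ᶜ : Set ℤ), w ^ ((x : ℤ) ^ 2).toNat‖ ≤
      ∑' x : ((({0, 1, -1} : Finset ℤ) : Set ℤ)ᶜ : Set ℤ), ‖w‖ ^ ((x : ℤ) ^ 2).toNat := by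
    refine (norm_tsum_le_tsum_norm (hs.subtype _)).trans_eq ?_
    simp
  refine (norm_add_le _ _).trans (add_le_add (le_of_eq ?_) (h3.trans (le_of_eq ?_)))
  · congr 1; ring
  · ring

/-- A finite power of an absolutely convergent sum, expanded as a sum over tuples. -/
lemma hasSum_prod_tuple {ι : Type*} {f : ι → ℂ} (hf : Summable fun i => ‖f i‖) (d : ℕ) :
    (Summable fun k : Fin d → ι => ‖∏ i, f (k i)‖) ∧
      HasSum (fun k : Fin d → ι => ∏ i, f (k i)) ((∑' i, f i) ^ d) := by
  induction d with
  | zero =>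
    refine ⟨(hasSum_fintype _).summable, ?_⟩
    simp
  | succ d ih =>
    have hn : Summable fun p : ι × (Fin d → ι) => ‖f p.1 * ∏ i, f (p.2 i)‖ :=
      Summable.mul_norm (f := f) (g := fun k : Fin d → ι => ∏ i, f (k i)) hf ih.1
    have hm := HasSum.mul (f := f) (g := fun k : Fin d → ι => ∏ i, f (k i)) hf.of_norm.hasSum ih.2
      (Summable.of_norm hn)
    let e : ι × (Fin d → ι) ≃ (Fin (d + 1) → ι) := Fin.consEquiv fun _ => ι
    have he : (fun k : Fin (d + 1) → ι => ∏ i, f (k i)) ∘ e =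
        fun p => f p.1 * ∏ i, f (p.2 i) := by
      ext p
      simp [e, Fin.prod_univ_succ, Fin.consEquiv]
    rw [← e.summable_iff, ← e.hasSum_iff, he, pow_succ']
    refine ⟨hn.congr fun p => ?_, hm⟩
    exact congrArg norm (congrFun he p).symm

/-- Exponent of the term indexed by `(k, j)` in the expansion of `h(w) ^ d / (1 - w)`. -/
def thetaExponent {d : ℕ} (p : (Fin d → ℤ) × ℕ) : ℕ := ∑ i, (p.1 i ^ 2).toNat + p.2

lemma hasSum_theta_pow_div {w : ℂ} (hw : ‖w‖ < 1) (d : ℕ) :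
    (Summable fun p : (Fin d → ℤ) × ℕ => ‖w ^ thetaExponent p‖) ∧
      HasSum (fun p : (Fin d → ℤ) × ℕ => w ^ thetaExponent p)
        (complexTheta w ^ d * (1 - w)⁻¹) := by
  have h1 := hasSum_prod_tuple (summable_norm_complexTheta hw) d
  have h2 : Summable fun j : ℕ => ‖w ^ j‖ := by
    simpa using summable_geometric_of_lt_one (norm_nonneg w) hw
  have hn := h1.1.mul_norm h2
  have he : (fun p : (Fin d → ℤ) × ℕ => w ^ thetaExponent p) =
      fun p => (∏ i, w ^ (p.1 i ^ 2).toNat) * w ^ p.2 := by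
    ext p
    rw [thetaExponent, pow_add, Finset.prod_pow_eq_pow_sum]
  refine ⟨?_, ?_⟩
  · convert hn using 2
    exact congrArg norm (congrFun he _)
  · rw [he]
    exact h1.2.mul (hasSum_geometric_of_norm_lt_one hw) hn.of_norm

lemma ncard_thetaExponent_eq (d m : ℕ) (γ : ℝ) (hm : γ * d = m) :
    {p : (Fin d → ℤ) × ℕ | thetaExponent p = m}.Finite ∧
      {p : (Fin d → ℤ) × ℕ | thetaExponent p = m}.ncard = N1 d γ := by
  have hA : {k : Fin d → ℤ | (∑ i, ((k i : ℝ)) ^ 2) ≤ γ * d} =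
      {k | ∑ i, (k i ^ 2).toNat ≤ m} := by
    ext k
    have : ∑ i, ((k i : ℝ)) ^ 2 = ((∑ i, (k i ^ 2).toNat : ℕ) : ℝ) := by
      push_cast
      refine Finset.sum_congr rfl fun i _ => ?_
      rw [toNat_sq_eq]
      push_cast
      rw [Nat.cast_natAbs, Int.cast_abs, sq_abs]
    rw [mem_ofPred_eq, mem_ofPred_eq, this, hm, Nat.cast_le]
  have hfin : {k : Fin d → ℤ | ∑ i, (k i ^ 2).toNat ≤ m}.Finite := by
    refine (Set.finite_Icc (fun _ : Fin d => -(m : ℤ)) (fun _ => (m : ℤ))).subset fun k hk => ?_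
    have hb : ∀ i, |k i| ≤ m := fun i => by
      have h1 := (Finset.single_le_sum (f := fun i => (k i ^ 2).toNat)
        (fun _ _ => Nat.zero_le _) (Finset.mem_univ i)).trans hk
      simp only [toNat_sq_eq] at h1
      have h2 := (Nat.le_self_pow two_ne_zero _).trans h1
      rw [Int.abs_eq_natAbs]
      exact_mod_cast h2
    exact ⟨fun i => (abs_le.1 (hb i)).1, fun i => (abs_le.1 (hb i)).2⟩
  have himg : {p : (Fin d → ℤ) × ℕ | thetaExponent p = m} =
      (fun k => (k, m - ∑ i, (k i ^ 2).toNat)) '' {k | ∑ i, (k i ^ 2).toNat ≤ m} := by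
    ext ⟨k, j⟩
    simp only [thetaExponent, mem_ofPred_eq, mem_image, Prod.mk.injEq]
    constructor
    · intro h
      exact ⟨k, by lia, rfl, by lia⟩
    · rintro ⟨k', h, rfl, rfl⟩
      lia
  rw [himg, N1, hA]
  exact ⟨hfin.image _, Set.ncard_image_of_injective _ fun a b h => (Prod.mk.inj h).1⟩

/-- Orthogonality of characters on the circle of radius `z`. -/
lemma integral_circle_pow {z : ℝ} (hz : 0 < z) (n m : ℕ) :
    ∫ θ in (-π)..π, (z * Complex.exp (θ * Complex.I)) ^ n *
      ((z * Complex.exp (θ * Complex.I)) ^ m)⁻¹ = if n = m then 2 * (π : ℂ) else 0 := by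
  have hz' : (z : ℂ) ≠ 0 := by exact_mod_cast hz.ne'
  split_ifs with h
  · subst h
    have : ∀ θ : ℝ, (z * Complex.exp (θ * Complex.I)) ^ n *
        ((z * Complex.exp (θ * Complex.I)) ^ n)⁻¹ = 1 := fun θ =>
      mul_inv_cancel₀ (pow_ne_zero _ (mul_ne_zero hz' (Complex.exp_ne_zero _)))
    simp only [this]
    simp
    ring
  · have hc : (((n : ℤ) - m : ℤ) : ℂ) * Complex.I ≠ 0 := by
      refine mul_ne_zero ?_ Complex.I_ne_zero
      exact Int.cast_ne_zero.2 (by lia)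
    have : ∀ θ : ℝ, (z * Complex.exp (θ * Complex.I)) ^ n *
        ((z * Complex.exp (θ * Complex.I)) ^ m)⁻¹ =
        z ^ n * ((z : ℂ) ^ m)⁻¹ * Complex.exp ((((n : ℤ) - m : ℤ) : ℂ) * Complex.I * θ) := by
      intro θ
      have : (((n : ℤ) - m : ℤ) : ℂ) * Complex.I * θ =
        n * (θ * Complex.I) - m * (θ * Complex.I) := by push_cast; ring
      rw [this, Complex.exp_sub, Complex.exp_nat_mul, Complex.exp_nat_mul, mul_pow, mul_pow]
      field_simp
    simp only [this]
    rw [intervalIntegral.integral_const_mul, integral_exp_mul_complex hc]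
    have hper : Complex.exp ((((n : ℤ) - m : ℤ) : ℂ) * Complex.I * π) =
        Complex.exp ((((n : ℤ) - m : ℤ) : ℂ) * Complex.I * (-π : ℝ)) := by
      rw [Complex.exp_eq_exp_iff_exists_int]
      exact ⟨(n : ℤ) - m, by push_cast; ring⟩
    rw [hper]
    simp

lemma norm_circle_point {z : ℝ} (hz : 0 ≤ z) (θ : ℝ) :
    ‖(z : ℂ) * Complex.exp (θ * Complex.I)‖ = z := by
  simp [Complex.norm_exp_ofReal_mul_I, abs_of_nonneg hz]

/-- Cauchy's formula for `N₁`. -/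
lemma N1_eq_integral {z : ℝ} (h0 : 0 < z) (h1 : z < 1) (d m : ℕ) (γ : ℝ) (hm : γ * d = m) :
    ∫ θ in (-π)..π, complexTheta (z * Complex.exp (θ * Complex.I)) ^ d *
      (1 - z * Complex.exp (θ * Complex.I))⁻¹ * ((z * Complex.exp (θ * Complex.I)) ^ m)⁻¹ =
      2 * π * (N1 d γ : ℂ) := by
  have hw : ∀ θ : ℝ, ‖(z : ℂ) * Complex.exp (θ * Complex.I)‖ < 1 := fun θ => by
    rwa [norm_circle_point h0.le]
  have hne : ∀ θ : ℝ, ((z : ℂ) * Complex.exp (θ * Complex.I)) ^ m ≠ 0 := fun θ =>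
    pow_ne_zero _ (mul_ne_zero (by exact_mod_cast h0.ne') (Complex.exp_ne_zero _))
  have hz1 : ‖(z : ℂ)‖ < 1 := by simpa [abs_of_pos h0] using h1
  have hsum := ((hasSum_theta_pow_div hz1 d).1.mul_right (z ^ m)⁻¹)
  have hS := intervalIntegral.hasSum_integral_of_dominated_convergence (a := -π) (b := π)
    (μ := MeasureTheory.volume)
    (F := fun (p : (Fin d → ℤ) × ℕ) (θ : ℝ) =>
      (z * Complex.exp (θ * Complex.I)) ^ thetaExponent p *
        ((z * Complex.exp (θ * Complex.I)) ^ m)⁻¹)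
    (f := fun θ => complexTheta (z * Complex.exp (θ * Complex.I)) ^ d *
      (1 - z * Complex.exp (θ * Complex.I))⁻¹ * ((z * Complex.exp (θ * Complex.I)) ^ m)⁻¹)
    (fun p _ => ‖(z : ℂ) ^ thetaExponent p‖ * (z ^ m)⁻¹)
    (fun p => by
      refine Continuous.aestronglyMeasurable ?_
      exact Continuous.mul (by fun_prop) (Continuous.inv₀ (by fun_prop) hne))
    (fun p => Eventually.of_forall fun θ _ => by
      simp [abs_of_pos h0, Complex.norm_exp_ofReal_mul_I])
    (Eventually.of_forall fun _ _ => hsum)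
    (by simp)
    (Eventually.of_forall fun θ _ => (hasSum_theta_pow_div (hw θ) d).2.mul_right _)
  simp only [integral_circle_pow h0] at hS
  obtain ⟨hfin, hcard⟩ := ncard_thetaExponent_eq d m γ hm
  have hval : ∑ p ∈ hfin.toFinset, (if thetaExponent p = m then 2 * (π : ℂ) else 0) =
      2 * π * (N1 d γ : ℂ) := by
    rw [Finset.sum_congr rfl (g := fun _ => 2 * (π : ℂ)) fun p hp => if_pos (by simpa using hp),
      Finset.sum_const, nsmul_eq_mul, ← hcard, Set.ncard_eq_toFinset_card _ hfin, mul_comm]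
  rw [← hval]
  exact hS.unique (hasSum_sum_of_ne_finset_zero (L := .unconditional _) fun p hp => by
    simpa using hp)

/-- Gaussian decay of the theta function along the circle of radius `z`. -/
lemma exists_norm_complexTheta_le_exp {z : ℝ} (h0 : 0 < z) (h1 : z < 1) :
    ∃ c > 0, ∀ θ : ℝ, |θ| ≤ π →
      ‖complexTheta (z * Complex.exp (θ * Complex.I)) / jacobiH z‖ ≤ exp (-c * θ ^ 2) := by
  have hH := jacobiH_pos h0.le h1
  have hpi := Real.pi_pos
  refine ⟨4 * z / (π ^ 2 * (1 + 2 * z)) / jacobiH z, by positivity, fun θ hθ => ?_⟩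
  set b := 2 * z * (1 - cos θ) / (1 + 2 * z) with hb
  have hcos := cos_le_one_sub_mul_cos_sq hθ
  have hbz : b * (1 + 2 * z) = 2 * z * (1 - cos θ) := by rw [hb]; field_simp
  have hb1 : b ≤ 1 + 2 * z := by
    rw [hb, div_le_iff₀ (by positivity)]
    nlinarith [neg_one_le_cos θ, sq_nonneg (1 - 2 * z)]
  have hb2 : 4 * z / (π ^ 2 * (1 + 2 * z)) * θ ^ 2 ≤ b := by
    have : 4 * z / (π ^ 2 * (1 + 2 * z)) * θ ^ 2 =
        2 * z * (2 / π ^ 2 * θ ^ 2) / (1 + 2 * z) := by field_simp; ring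
    rw [this, hb]
    gcongr
    linarith
  have hn : ‖1 + 2 * ((z : ℂ) * Complex.exp (θ * Complex.I))‖ ≤ 1 + 2 * z - b := by
    refine (pow_le_pow_iff_left₀ (norm_nonneg _) (by linarith) two_ne_zero).1 ?_
    have he : ‖1 + 2 * ((z : ℂ) * Complex.exp (θ * Complex.I))‖ ^ 2 =
        1 + 4 * z * cos θ + 4 * z ^ 2 := by
      rw [Complex.sq_norm, Complex.normSq_apply]
      simp [Complex.exp_ofReal_mul_I_re, Complex.exp_ofReal_mul_I_im]
      linear_combination 4 * z ^ 2 * sin_sq_add_cos_sq θ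
    rw [he]
    nlinarith [sq_nonneg b]
  have hle := norm_complexTheta_le (w := z * Complex.exp (θ * Complex.I))
    (by rwa [norm_circle_point h0.le])
  rw [norm_circle_point h0.le] at hle
  rw [norm_div, Complex.norm_real, norm_of_nonneg hH.le, div_le_iff₀ hH]
  calc _ ≤ jacobiH z - 4 * z / (π ^ 2 * (1 + 2 * z)) * θ ^ 2 := by linarith
    _ = (-(4 * z / (π ^ 2 * (1 + 2 * z)) / jacobiH z) * θ ^ 2 + 1) * jacobiH z := by
      field_simp
      ring
    _ ≤ _ := by
      gcongr
      exact add_one_le_exp _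

/-- The derivative of a real function that extends analytically is the restriction of the
derivative of the extension. -/
lemma eventually_deriv_ofReal {f : ℂ → ℂ} {g : ℝ → ℝ} {x : ℝ} (hf : AnalyticAt ℂ f x)
    (h : ∀ᶠ y : ℝ in nhds x, f y = g y) : ∀ᶠ y : ℝ in nhds x, deriv f y = (deriv g y : ℝ) := by
  have hc : Tendsto (fun y : ℝ => (y : ℂ)) (nhds x) (nhds x) :=
    Complex.continuous_ofReal.tendsto x
  filter_upwards [h.eventually_nhds, hc.eventually hf.eventually_analyticAt] with y hy hfy
  have hd := hfy.differentiableAt.hasDerivAt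
  have hg : HasDerivAt g (deriv f y).re y := by
    refine hd.real_of_complex.congr_of_eventuallyEq ?_
    filter_upwards [hy] with t ht
    rw [ht, Complex.ofReal_re]
  rw [hg.deriv]
  have h1 := hd.comp_ofReal
  refine h1.unique (hg.ofReal_comp.congr_of_eventuallyEq ?_)
  filter_upwards [hy] with t ht using ht

/-- Second-order Taylor expansion at a critical point, on the scale `1 / √d`. -/
lemma tendsto_mul_sub_of_deriv_eq_zero {M : ℂ → ℂ} (hM : AnalyticAt ℂ M 0) (h1 : deriv M 0 = 0)
    (t : ℝ) :
    Tendsto (fun d : ℕ => (d : ℂ) * (M ((t / √d : ℝ) * Complex.I) - M 0)) atTop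
      (nhds (-(t ^ 2 / 2) * deriv (deriv M) 0)) := by
  have hs : Tendsto (fun d : ℕ => t / √(d : ℝ)) atTop (nhds 0) :=
    tendsto_const_nhds.div_atTop (tendsto_sqrt_atTop.comp tendsto_natCast_atTop_atTop)
  have hy : Tendsto (fun d : ℕ => ((t / √d : ℝ) : ℂ) * Complex.I) atTop (nhds 0) := by
    have := ((Complex.continuous_ofReal.tendsto 0).comp hs).mul_const Complex.I
    simpa using this
  have hO := (hM.hasFPowerSeriesAt.isBigO_sub_partialSum_pow 3).comp_tendsto hy
  have hps : ∀ y : ℂ, (FormalMultilinearSeries.ofScalars ℂ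
      (fun n => iteratedDeriv n M 0 / n.factorial)).partialSum 3 y =
      M 0 + deriv (deriv M) 0 / 2 * y ^ 2 := by
    intro y
    simp [FormalMultilinearSeries.partialSum, Finset.sum_range_succ, iteratedDeriv_succ, h1]
    ring
  simp only [hps, Function.comp_def, zero_add] at hO
  have hlim : Tendsto (fun d : ℕ => (d : ℂ) * (M ((t / √d : ℝ) * Complex.I) -
      (M 0 + deriv (deriv M) 0 / 2 * ((t / √d : ℝ) * Complex.I) ^ 2))) atTop (nhds 0) := by
    have hd : (fun d : ℕ => (d : ℂ)) =O[atTop] fun d : ℕ => (d : ℝ) :=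
      .of_bound 1 (by simp)
    refine (hd.mul hO).trans_tendsto ?_
    have h0 : Tendsto (fun d : ℕ => t ^ 2 * |t / √(d : ℝ)|) atTop (nhds 0) := by
      simpa using hs.abs.const_mul (t ^ 2)
    refine h0.congr' ?_
    filter_upwards [eventually_gt_atTop 0] with d hd
    have hd' : (0 : ℝ) < d := by exact_mod_cast hd
    rw [norm_mul, Complex.norm_I, mul_one, Complex.norm_real, norm_eq_abs, pow_succ _ 2, sq_abs,
      div_pow, sq_sqrt hd'.le]
    field_simp
  have := hlim.add_const (-(t ^ 2 / 2) * deriv (deriv M) 0 : ℂ)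
  rw [zero_add] at this
  refine this.congr' ?_
  filter_upwards [eventually_gt_atTop 0] with d hd
  have hd' : (0 : ℝ) < d := by exact_mod_cast hd
  have hsq : (((t / √d : ℝ) : ℂ)) ^ 2 * d = t ^ 2 := by
    have : (t / √(d : ℝ)) ^ 2 * d = t ^ 2 := by
      rw [div_pow, sq_sqrt hd'.le]
      field_simp
    exact_mod_cast this
  rw [mul_pow, Complex.I_sq]
  linear_combination (deriv (deriv M) 0 / 2) * hsq

/-- The characteristic function at `θ` of `X ^ 2 - γ`, where the integer `X` takes the value `r`
with probability `z ^ (r ^ 2) / h(z)`. -/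
noncomputable def tiltedChar (γ z θ : ℝ) : ℂ :=
  complexTheta (z * Complex.exp (θ * Complex.I)) / jacobiH z *
    Complex.exp (-(γ * θ : ℝ) * Complex.I)

lemma continuous_complexTheta_circle {z : ℝ} (h0 : 0 < z) (h1 : z < 1) :
    Continuous fun θ : ℝ => complexTheta (z * Complex.exp (θ * Complex.I)) :=
  differentiableOn_complexTheta.continuousOn.comp_continuous (by fun_prop) fun θ => by
    rwa [mem_ball_zero_iff, norm_circle_point h0.le]

lemma continuous_tiltedChar (γ : ℝ) {z : ℝ} (h0 : 0 < z) (h1 : z < 1) :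
    Continuous (tiltedChar γ z) :=
  ((continuous_complexTheta_circle h0 h1).div_const _).mul (by fun_prop)

lemma norm_tiltedChar (γ z θ : ℝ) : ‖tiltedChar γ z θ‖ =
    ‖complexTheta (z * Complex.exp (θ * Complex.I)) / jacobiH z‖ := by
  rw [tiltedChar, norm_mul, ← Complex.ofReal_neg, Complex.norm_exp_ofReal_mul_I, mul_one]

/-- The complex extension of `lgam γ` near the interval `(0, 1)`. -/
noncomputable def complexLgam (γ : ℝ) (w : ℂ) : ℂ :=
  Complex.log (complexTheta w) - γ * Complex.log w

lemma analyticAt_complexLgam (γ : ℝ) {z : ℝ} (h0 : 0 < z) (h1 : z < 1) :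
    AnalyticAt ℂ (complexLgam γ) z := by
  have hT : AnalyticAt ℂ complexTheta z :=
    differentiableOn_complexTheta.analyticAt (Metric.isOpen_ball.mem_nhds (by
      simpa [abs_of_pos h0] using h1))
  refine (hT.clog ?_).sub (analyticAt_const.mul (analyticAt_id.clog ?_))
  · rw [complexTheta_ofReal]
    exact Complex.ofReal_mem_slitPlane.2 (jacobiH_pos h0.le h1)
  · exact Complex.ofReal_mem_slitPlane.2 h0

lemma complexLgam_ofReal (γ : ℝ) {x : ℝ} (h0 : 0 < x) (h1 : x < 1) :
    complexLgam γ x = lgam γ x := by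
  rw [complexLgam, lgam, complexTheta_ofReal, ← Complex.ofReal_log (jacobiH_pos h0.le h1).le,
    ← Complex.ofReal_log h0.le]
  push_cast
  rfl

/-- At a critical point of `lgam γ`, the powers of the tilted characteristic function converge to
that of a centred Gaussian. -/
lemma tendsto_tiltedChar_pow {γ z : ℝ} (h0 : 0 < z) (h1 : z < 1) (hcrit : deriv (lgam γ) z = 0)
    (t : ℝ) :
    Tendsto (fun d : ℕ => tiltedChar γ z (t / √d) ^ d) atTop
      (nhds (exp (-(z ^ 2 * deriv (deriv (lgam γ)) z / 2) * t ^ 2) : ℝ)) := by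
  have hA := analyticAt_complexLgam γ h0 h1
  have hIoo : ∀ᶠ y : ℝ in nhds z, complexLgam γ y = lgam γ y := by
    filter_upwards [Ioo_mem_nhds h0 h1] with y hy using complexLgam_ofReal γ hy.1 hy.2
  have hev1 := eventually_deriv_ofReal hA hIoo
  have hd1 : deriv (complexLgam γ) z = 0 := by simpa [hcrit] using hev1.self_of_nhds
  have hd2 := (eventually_deriv_ofReal hA.deriv hev1).self_of_nhds
  have hexp : ∀ w : ℂ, HasDerivAt (fun w : ℂ => (z : ℂ) * Complex.exp w) (z * Complex.exp w) w :=
    fun w => (Complex.hasDerivAt_exp w).const_mul _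
  have hz0 : (z : ℂ) * Complex.exp 0 = z := by simp
  have hcont : Tendsto (fun w : ℂ => (z : ℂ) * Complex.exp w) (nhds 0) (nhds z) := by
    simpa using (hexp 0).continuousAt.tendsto
  set M : ℂ → ℂ := fun w => complexLgam γ (z * Complex.exp w) with hMdef
  have hMA : AnalyticAt ℂ M 0 :=
    AnalyticAt.fun_comp (g := complexLgam γ) (by rwa [hz0]) (analyticAt_const.mul analyticAt_cexp)
  have hM1 : deriv M =ᶠ[nhds 0]
      fun w => deriv (complexLgam γ) (z * Complex.exp w) * (z * Complex.exp w) := by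
    filter_upwards [hcont.eventually hA.eventually_analyticAt] with w hw
    exact (hw.differentiableAt.hasDerivAt.comp w (hexp w)).deriv
  have hM1z : deriv M 0 = 0 := by rw [hM1.eq_of_nhds, hz0, hd1, zero_mul]
  have hM2 : deriv (deriv M) 0 = z ^ 2 * (deriv (deriv (lgam γ)) z : ℝ) := by
    rw [hM1.deriv_eq, ← hd2]
    have hc : HasDerivAt (fun w => deriv (complexLgam γ) (z * Complex.exp w))
        (deriv (deriv (complexLgam γ)) z * z) 0 := by
      have := HasDerivAt.comp (h₂ := deriv (complexLgam γ)) 0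
        (by rw [hz0]; exact hA.deriv.differentiableAt.hasDerivAt) (hexp 0)
      rwa [hz0] at this
    have := (hc.mul (hexp 0)).deriv
    rw [hz0, hd1] at this
    refine Eq.trans this ?_
    ring
  have hlim := (Complex.continuous_exp.tendsto _).comp
    (tendsto_mul_sub_of_deriv_eq_zero hMA hM1z t)
  have hval : Complex.exp (-(t ^ 2 / 2) * deriv (deriv M) 0) =
      (exp (-(z ^ 2 * deriv (deriv (lgam γ)) z / 2) * t ^ 2) : ℝ) := by
    rw [hM2]
    push_cast
    congr 1
    ring
  rw [hval] at hlim
  refine hlim.congr' ?_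
  have hs : Tendsto (fun d : ℕ => t / √(d : ℝ)) atTop (nhds 0) :=
    tendsto_const_nhds.div_atTop (tendsto_sqrt_atTop.comp tendsto_natCast_atTop_atTop)
  have hy : Tendsto (fun θ : ℝ => (z : ℂ) * Complex.exp (θ * Complex.I)) (nhds 0) (nhds z) := by
    have : Continuous fun θ : ℝ => (z : ℂ) * Complex.exp (θ * Complex.I) := by fun_prop
    simpa using this.tendsto 0
  have hne : ∀ᶠ w in nhds (z : ℂ), complexTheta w ≠ 0 := by
    refine ContinuousAt.eventually_ne ?_ ?_
    · exact differentiableOn_complexTheta.continuousOn.continuousAt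
        (Metric.isOpen_ball.mem_nhds (by simpa [abs_of_pos h0] using h1))
    · rw [complexTheta_ofReal]
      exact_mod_cast (jacobiH_pos h0.le h1).ne'
  have hH : (jacobiH z : ℂ) ≠ 0 := by exact_mod_cast (jacobiH_pos h0.le h1).ne'
  filter_upwards [hs.eventually (hy.eventually hne),
    hs.eventually (Ioo_mem_nhds (neg_lt_zero.2 pi_pos) pi_pos)] with d hd hpi
  rw [Function.comp_apply, Complex.exp_nat_mul]
  congr 1
  have hM0 : M 0 = complexLgam γ z := by rw [hMdef]; simp
  have hlog : Complex.log (z * Complex.exp ((t / √d : ℝ) * Complex.I)) =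
      Complex.log z + (t / √d : ℝ) * Complex.I := by
    rw [Complex.log_ofReal_mul h0 (Complex.exp_ne_zero _), Complex.log_exp,
      Complex.ofReal_log h0.le]
    · simpa using hpi.1
    · simpa using hpi.2.le
  rw [hM0]
  simp only [hMdef, complexLgam, tiltedChar]
  rw [hlog, complexTheta_ofReal]
  have : Complex.log (complexTheta (z * Complex.exp ((t / √d : ℝ) * Complex.I))) -
      γ * (Complex.log z + (t / √d : ℝ) * Complex.I) -
      (Complex.log (jacobiH z) - γ * Complex.log z) =
      Complex.log (complexTheta (z * Complex.exp ((t / √d : ℝ) * Complex.I))) -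
        Complex.log (jacobiH z) + -(γ * (t / √d) : ℝ) * Complex.I := by
    push_cast
    ring
  rw [this, Complex.exp_add, Complex.exp_sub, Complex.exp_log hd, Complex.exp_log hH]

lemma sq_mul_deriv_deriv_lgam_pos {γ z : ℝ} (h0 : 0 < z) (h1 : z < 1)
    (hcrit : deriv (lgam γ) z = 0) : 0 < z ^ 2 * deriv (deriv (lgam γ)) z := by
  obtain ⟨c, hc, hbound⟩ := exists_norm_complexTheta_le_exp h0 h1
  have hlim := (tendsto_tiltedChar_pow h0 h1 hcrit 1).norm
  have hle := le_of_tendsto hlim (b := exp (-c)) (by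
    filter_upwards [eventually_gt_atTop 0] with d hd
    have hd' : (1 : ℝ) ≤ d := by exact_mod_cast hd
    have hs : 1 ≤ √(d : ℝ) := by rw [one_le_sqrt]; exact hd'
    have hb := hbound (1 / √(d : ℝ)) (by
      rw [abs_of_pos (by positivity)]
      exact ((div_le_one (by positivity)).2 hs).trans (by linarith [pi_gt_three]))
    rw [norm_pow, norm_tiltedChar]
    refine (pow_le_pow_left₀ (norm_nonneg _) hb d).trans_eq ?_
    rw [← exp_nat_mul, div_pow, sq_sqrt (by positivity)]
    congr 1
    field_simp)
  rw [Complex.norm_real, norm_of_nonneg (exp_pos _).le, exp_le_exp] at hle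
  linarith

/-- Laplace's method for the integral of the tilted characteristic function. -/
lemma tendsto_sqrt_mul_integral {γ z : ℝ} (h0 : 0 < z) (h1 : z < 1)
    (hcrit : deriv (lgam γ) z = 0) :
    Tendsto (fun d : ℕ => (√(d : ℝ) : ℂ) * ∫ θ in (-π)..π, tiltedChar γ z θ ^ d *
      (1 - z * Complex.exp (θ * Complex.I))⁻¹) atTop
      (nhds ((√(2 * π / (z ^ 2 * deriv (deriv (lgam γ)) z)) * (1 - z)⁻¹ : ℝ) : ℂ)) := by
  obtain ⟨c, hc, hbound⟩ := exists_norm_complexTheta_le_exp h0 h1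
  set s := z ^ 2 * deriv (deriv (lgam γ)) z with hs
  set g : ℝ → ℂ := fun θ => (1 - z * Complex.exp (θ * Complex.I))⁻¹ with hg
  have hgne : ∀ θ : ℝ, (1 : ℂ) - z * Complex.exp (θ * Complex.I) ≠ 0 := fun θ h => by
    have := norm_circle_point h0.le θ
    rw [← sub_eq_zero.1 h, norm_one] at this
    linarith
  have hgcont : Continuous g := Continuous.inv₀ (by fun_prop) hgne
  have hgle : ∀ θ, ‖g θ‖ ≤ (1 - z)⁻¹ := fun θ => by
    rw [hg, norm_inv]
    refine inv_anti₀ (by linarith) ?_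
    have := norm_sub_norm_le (1 : ℂ) (z * Complex.exp (θ * Complex.I))
    rwa [norm_one, norm_circle_point h0.le] at this
  set F : ℕ → ℝ → ℂ := fun d => (Ioc (-(π * √(d : ℝ))) (π * √(d : ℝ))).indicator
    fun t => tiltedChar γ z (t / √d) ^ d * g (t / √d) with hF
  have hFint : ∀ᶠ d : ℕ in atTop, ∫ t, F d t =
      (√(d : ℝ) : ℂ) * ∫ θ in (-π)..π, tiltedChar γ z θ ^ d * g θ := by
    filter_upwards [eventually_gt_atTop 0] with d hd
    have hd' : 0 < √(d : ℝ) := by positivity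
    rw [hF, MeasureTheory.integral_indicator measurableSet_Ioc,
      ← intervalIntegral.integral_of_le (by nlinarith [pi_pos]),
      intervalIntegral.integral_comp_div (fun θ => tiltedChar γ z θ ^ d * g θ) hd'.ne', neg_div,
      mul_div_cancel_right₀ _ hd'.ne', Complex.real_smul]
  have hlim : Tendsto (fun d => ∫ t, F d t) atTop
      (nhds (∫ t, ((exp (-(s / 2) * t ^ 2) * (1 - z)⁻¹ : ℝ) : ℂ))) := by
    refine MeasureTheory.tendsto_integral_filter_of_dominated_convergence
      (fun t => exp (-c * t ^ 2) * (1 - z)⁻¹) ?_ ?_ ?_ ?_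
    · refine Eventually.of_forall fun d => ?_
      refine Measurable.aestronglyMeasurable (Measurable.indicator ?_ measurableSet_Ioc)
      have hcont := continuous_tiltedChar γ h0 h1
      exact Continuous.measurable (by fun_prop)
    · filter_upwards [eventually_gt_atTop 0] with d hd
      have hd' : 0 < √(d : ℝ) := by positivity
      refine Eventually.of_forall fun t => ?_
      by_cases ht : t ∈ Ioc (-(π * √(d : ℝ))) (π * √(d : ℝ))
      · simp only [hF]
        rw [indicator_of_mem ht, norm_mul, norm_pow, norm_tiltedChar]
        have hb := hbound (t / √(d : ℝ)) (by
          rw [abs_div, abs_of_pos hd', div_le_iff₀ hd', abs_le]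
          exact ⟨ht.1.le, ht.2⟩)
        refine mul_le_mul ((pow_le_pow_left₀ (norm_nonneg _) hb d).trans_eq ?_) (hgle _)
          (norm_nonneg _) (exp_pos _).le
        rw [← exp_nat_mul, div_pow, sq_sqrt (by positivity)]
        congr 1
        field_simp
      · simp only [hF]
        rw [indicator_of_notMem ht, norm_zero]
        have : 0 < 1 - z := by linarith
        positivity
    · exact (integrable_exp_neg_mul_sq hc).mul_const _
    · refine Eventually.of_forall fun t => ?_
      have hst : Tendsto (fun d : ℕ => t / √(d : ℝ)) atTop (nhds 0) :=
        tendsto_const_nhds.div_atTop (tendsto_sqrt_atTop.comp tendsto_natCast_atTop_atTop)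
      have hgt : Tendsto (fun d : ℕ => g (t / √d)) atTop (nhds ((1 - z)⁻¹ : ℝ)) := by
        have := (hgcont.tendsto 0).comp hst
        have hg0 : g 0 = ((1 - z)⁻¹ : ℝ) := by simp [hg]
        rwa [hg0] at this
      rw [Complex.ofReal_mul]
      refine ((tendsto_tiltedChar_pow h0 h1 hcrit t).mul hgt).congr' ?_
      have hbig : Tendsto (fun d : ℕ => π * √(d : ℝ)) atTop atTop :=
        (tendsto_sqrt_atTop.comp tendsto_natCast_atTop_atTop).const_mul_atTop pi_pos
      filter_upwards [hbig.eventually_gt_atTop |t|] with d hd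
      simp only [hF]
      rw [indicator_of_mem]
      exact ⟨(abs_lt.1 hd).1, (abs_lt.1 hd).2.le⟩
  rw [integral_complex_ofReal, MeasureTheory.integral_mul_const, integral_gaussian] at hlim
  have hsimp : π / (s / 2) = 2 * π / s := by rw [div_div_eq_mul_div, mul_comm]
  rw [hsimp] at hlim
  exact hlim.congr' hFint

/-- For a positive rational `γ`, with `z_γ ∈ (0,1)` the unique root of
`l_γ'`, as `d → ∞` along integers with `γ d ∈ ℤ`,
`N₁(d,γ) (z_γ^γ / h(z_γ))^d z_γ (1 − z_γ) √(2 l_γ''(z_γ) π d) → 1`. -/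
theorem N1_asymptotics (γ : ℚ) (hγ : 0 < γ) (zγ : ℝ)
    (hzγ : zγ ∈ Set.Ioo (0 : ℝ) 1 ∧ deriv (lgam (γ : ℝ)) zγ = 0)
    (huniq : ∀ z : ℝ, z ∈ Set.Ioo (0 : ℝ) 1 ∧ deriv (lgam (γ : ℝ)) z = 0 → z = zγ) :
    Filter.Tendsto
      (fun d : ℕ => (N1 d (γ : ℝ) : ℝ) * (zγ ^ (γ : ℝ) / jacobiH zγ) ^ d *
        (zγ * (1 - zγ) * Real.sqrt (2 * deriv (deriv (lgam (γ : ℝ))) zγ * Real.pi * d)))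
      (alongIntMultiples γ) (nhds 1) := by
  obtain ⟨⟨h0, h1⟩, hcrit⟩ := hzγ
  have hs := sq_mul_deriv_deriv_lgam_pos h0 h1 hcrit
  have hL : 0 < deriv (deriv (lgam (γ : ℝ))) zγ := pos_of_mul_pos_right hs (by positivity)
  set L := deriv (deriv (lgam (γ : ℝ))) zγ with hLdef
  have h1z : 0 < 1 - zγ := by linarith
  have hlim := (tendsto_sqrt_mul_integral h0 h1 hcrit).mul_const
    (((2 * π)⁻¹ * (zγ * (1 - zγ) * √(2 * L * π)) : ℝ) : ℂ)
  have hone : √(2 * π / (zγ ^ 2 * L)) * (1 - zγ)⁻¹ *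
      ((2 * π)⁻¹ * (zγ * (1 - zγ) * √(2 * L * π))) = 1 := by
    have hpi := pi_pos
    have hsq : √(2 * π / (zγ ^ 2 * L)) * √(2 * L * π) = 2 * π / zγ := by
      rw [← sqrt_mul (by positivity), sqrt_eq_iff_mul_self_eq (by positivity) (by positivity)]
      field_simp
    calc _ = (√(2 * π / (zγ ^ 2 * L)) * √(2 * L * π)) * ((1 - zγ)⁻¹ *
        ((2 * π)⁻¹ * (zγ * (1 - zγ)))) := by ring
      _ = 1 := by
        rw [hsq]
        field_simp
  rw [← Complex.ofReal_mul, hone] at hlim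
  have hre := (Complex.continuous_re.tendsto _).comp hlim
  rw [Complex.ofReal_re] at hre
  refine (hre.mono_left inf_le_left).congr' ?_
  refine mem_inf_of_right (mem_principal.2 ?_)
  rintro d ⟨m', hm'⟩
  have hm0 : 0 ≤ m' := by
    have : (0 : ℝ) ≤ m' := hm' ▸ by positivity
    exact_mod_cast this
  obtain ⟨m, rfl⟩ := Int.eq_ofNat_of_zero_le hm0
  have hm : (γ : ℝ) * d = m := by exact_mod_cast hm'
  have hH := jacobiH_pos h0.le h1
  have hint : ∫ θ in (-π)..π, tiltedChar γ zγ θ ^ d *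
      (1 - zγ * Complex.exp (θ * Complex.I))⁻¹ =
      ((zγ ^ m / jacobiH zγ ^ d * (2 * π * N1 d γ) : ℝ) : ℂ) := by
    have hN := N1_eq_integral h0 h1 d m γ hm
    have hzc : (zγ : ℂ) ≠ 0 := by exact_mod_cast h0.ne'
    have : ∀ θ : ℝ, tiltedChar γ zγ θ ^ d * (1 - zγ * Complex.exp (θ * Complex.I))⁻¹ =
        (zγ ^ m / jacobiH zγ ^ d : ℂ) *
        (complexTheta (zγ * Complex.exp (θ * Complex.I)) ^ d *
        (1 - zγ * Complex.exp (θ * Complex.I))⁻¹ *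
          ((zγ * Complex.exp (θ * Complex.I)) ^ m)⁻¹) := by
      intro θ
      have he : Complex.exp (-((γ : ℝ) * θ : ℝ) * Complex.I) ^ d =
          (Complex.exp (θ * Complex.I) ^ m)⁻¹ := by
        rw [← Complex.exp_nat_mul, ← Complex.exp_nat_mul, ← Complex.exp_neg]
        congr 1
        have hmc : ((γ : ℝ) : ℂ) * d = m := by exact_mod_cast hm
        rw [Complex.ofReal_mul]
        linear_combination (-θ * Complex.I) * hmc
      rw [tiltedChar, mul_pow, he, div_pow, mul_pow, mul_inv]
      field_simp
    simp only [this]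
    rw [intervalIntegral.integral_const_mul, hN]
    push_cast
    rfl
  have hpow : (zγ ^ (γ : ℝ) / jacobiH zγ) ^ d = zγ ^ m / jacobiH zγ ^ d := by
    rw [div_pow, ← rpow_natCast (zγ ^ (γ : ℝ)), ← rpow_mul h0.le, hm, rpow_natCast]
  rw [mem_ofPred_eq, Function.comp_apply, hint]
  beta_reduce
  rw [hpow, ← Complex.ofReal_mul, ← Complex.ofReal_mul,
    Complex.ofReal_re, sqrt_mul (x := 2 * L * π) (by positivity) d]
  have hpi := pi_pos
  field_simp
end
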